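/- If (a₁,a₂,a₃,a₄) is, up to cyclic rotation and/or reversal, equal to (p,p,p,p) or to (p,p,p,2p) for some positive integer p, then there is no continuous Q₄ₙ-equivariant map F : S³ → M_D(α). -/

import Mathlib

noncomputable section

open scoped BigOperators

/-- The cyclic shift `σ(x₁,…,xₙ) = (x₂,…,xₙ,x₁)`, i.e. `(σ x) i = x (i+1)`. -/
def cyclicShift (n : ℕ) (x : Fin n → ℝ) : Fin n → ℝ := fun i => x (finRotate n i)

/-- The reversal `τ(x₁,…,xₙ) = (xₙ,…,x₂,x₁)`. -/
def revShift (n : ℕ) (x : Fin n → ℝ) : Fin n → ℝ := fun i => x i.rev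

/-- The hyperplane `Wₙ = {x ∈ ℝⁿ : x₁ + ⋯ + xₙ = 0}`. -/
def Wset (n : ℕ) : Set (Fin n → ℝ) := {x | ∑ i, x i = 0}

/-- The linear subspace `L(α) ⊆ Wₙ` cut out by the vanishing of the four consecutive
block sums of lengths `a₁, a₂, a₃, a₄`. -/
def Lset (n a₁ a₂ a₃ a₄ : ℕ) : Set (Fin n → ℝ) :=
  {x | x ∈ Wset n ∧
    ∑ i ∈ Finset.univ.filter (fun i : Fin n => (i : ℕ) < a₁), x i = 0 ∧
    ∑ i ∈ Finset.univ.filter (fun i : Fin n => a₁ ≤ (i : ℕ) ∧ (i : ℕ) < a₁ + a₂), x i = 0 ∧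
    ∑ i ∈ Finset.univ.filter
      (fun i : Fin n => a₁ + a₂ ≤ (i : ℕ) ∧ (i : ℕ) < a₁ + a₂ + a₃), x i = 0 ∧
    ∑ i ∈ Finset.univ.filter (fun i : Fin n => a₁ + a₂ + a₃ ≤ (i : ℕ)), x i = 0}

/-- The union `⋃ A_D(α)` of the smallest family of linear subspaces containing `L(α)`
that is invariant under the cyclic shift `σ` and the reversal `τ`; it consists of the
subspaces `σᵏ·L(α)` and `σᵏ·(τ·L(α))`, `0 ≤ k < n`. -/
def dihArrangementUnion (n a₁ a₂ a₃ a₄ : ℕ) : Set (Fin n → ℝ) :=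
  (⋃ k ∈ Finset.range n, (cyclicShift n)^[k] '' Lset n a₁ a₂ a₃ a₄) ∪
  (⋃ k ∈ Finset.range n, (cyclicShift n)^[k] '' (revShift n '' Lset n a₁ a₂ a₃ a₄))

/-- The complement `M_D(α) = Wₙ \ ⋃ A_D(α)`. -/
def Mdih (n a₁ a₂ a₃ a₄ : ℕ) : Set (Fin n → ℝ) :=
  Wset n \ dihArrangementUnion n a₁ a₂ a₃ a₄

/-- The quaternion `ε = cos(π/n) + i·sin(π/n)`. -/
def epsQ (n : ℕ) : Quaternion ℝ :=
  ⟨Real.cos (Real.pi / n), Real.sin (Real.pi / n), 0, 0⟩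

/-- The quaternion `j`. -/
def jQ : Quaternion ℝ := ⟨0, 0, 1, 0⟩

lemma norm_epsQ (n : ℕ) : ‖epsQ n‖ = 1 := by
  have h : Quaternion.normSq (epsQ n) = 1 := by
    rw [Quaternion.normSq_def']
    show Real.cos (Real.pi / n) ^ 2 + Real.sin (Real.pi / n) ^ 2 + 0 ^ 2 + 0 ^ 2 = 1
    have := Real.cos_sq_add_sin_sq (Real.pi / n)
    nlinarith
  have h2 := Quaternion.normSq_eq_norm_mul_self (epsQ n)
  rw [h] at h2
  nlinarith [norm_nonneg (epsQ n)]

lemma norm_jQ : ‖jQ‖ = 1 := by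
  have h : Quaternion.normSq jQ = 1 := by
    rw [Quaternion.normSq_def']
    show (0:ℝ) ^ 2 + 0 ^ 2 + 1 ^ 2 + 0 ^ 2 = 1
    norm_num
  have h2 := Quaternion.normSq_eq_norm_mul_self jQ
  rw [h] at h2
  nlinarith [norm_nonneg jQ]

/-- The sphere `S³` of unit quaternions. -/
abbrev UnitQuat : Type := {q : Quaternion ℝ // ‖q‖ = 1}

/-- Existence of a continuous `Q₄ₙ`-equivariant map `S³ → M_D(α)`: equivariance with respect
to the generators `ε` (acting on `Wₙ` as `σ`) and `j` (acting as `τ`). -/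
def ExistsQuatEquivariantMap (n a₁ a₂ a₃ a₄ : ℕ) : Prop :=
  ∃ F : UnitQuat → {x : Fin n → ℝ // x ∈ Mdih n a₁ a₂ a₃ a₄},
    Continuous F ∧
    (∀ q : UnitQuat,
      (F ⟨epsQ n * q.1, by rw [norm_mul, norm_epsQ, q.2, one_mul]⟩).1
        = cyclicShift n (F q).1) ∧
    (∀ q : UnitQuat,
      (F ⟨jQ * q.1, by rw [norm_mul, norm_jQ, q.2, one_mul]⟩).1
        = revShift n (F q).1)

namespace ListChain

variable {R : Type*} [CommRing R] {α β E : Type*}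

/-- Formal combinations of ordered simplices, a simplex being its list of vertices. The empty list
plays the role of the augmentation. -/
abbrev Chain (R : Type*) [CommRing R] (α : Type*) := List α →₀ R

/-- The cone with a given apex. -/
def cone (R : Type*) [CommRing R] {α : Type*} (a : α) : Chain R α →ₗ[R] Chain R α :=
  Finsupp.lmapDomain R R (List.cons a)

/-- The boundary of a single simplex. -/
def faces (R : Type*) [CommRing R] {α : Type*} : List α → Chain R α
  | [] => 0
  | a :: l => Finsupp.single l 1 - cone R a (faces R l)

/-- The augmented simplicial boundary. -/
def bd : Chain R α →ₗ[R] Chain R α := Finsupp.linearCombination R (faces R)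

/-- The chain map induced by a map of vertices. -/
def act (R : Type*) [CommRing R] {α β : Type*} (f : α → β) : Chain R α →ₗ[R] Chain R β :=
  Finsupp.lmapDomain R R (List.map f)

/-- Evaluation of a cochain on a chain. -/
def ev (f : List α → R) : Chain R α →ₗ[R] R := Finsupp.linearCombination R f

/-- Chains all of whose simplices satisfy a predicate. -/
abbrev Sup (R : Type*) [CommRing R] {α : Type*} (P : List α → Prop) : Submodule R (Chain R α) :=
  Finsupp.supported R R {l | P l}

@[simp] lemma cone_single (a : α) (l : List α) (r : R) :
    cone R a (Finsupp.single l r) = Finsupp.single (a :: l) r := by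
  simp [cone]

@[simp] lemma act_single (f : α → β) (l : List α) (r : R) :
    act R f (Finsupp.single l r) = Finsupp.single (l.map f) r := by
  simp [act]

@[simp] lemma bd_single (l : List α) : bd (Finsupp.single l (1 : R)) = faces R l := by
  simp [bd]

@[simp] lemma ev_single (f : List α → R) (l : List α) (r : R) :
    ev f (Finsupp.single l r) = r * f l := by
  simp [ev]

lemma ext_single {M : Type*} [AddCommGroup M] [Module R M] {S T : Chain R α →ₗ[R] M}
    (h : ∀ l, S (Finsupp.single l 1) = T (Finsupp.single l 1)) (z : Chain R α) : S z = T z := by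
  have : S = T := by
    ext l
    simpa using h l
  rw [this]

lemma bd_cone (a : α) (z : Chain R α) : bd (cone R a z) = z - cone R a (bd z) :=
  ext_single (S := bd ∘ₗ cone R a) (T := LinearMap.id - cone R a ∘ₗ bd)
    (fun l => by simp [faces]) z

lemma bd_faces (l : List α) : bd (faces R l) = 0 := by
  induction l with
  | nil => simp [faces]
  | cons a l ih => simp [faces, bd_cone, ih]

lemma act_cone (f : α → β) (a : α) (z : Chain R α) :
    act R f (cone R a z) = cone R (f a) (act R f z) :=
  ext_single (S := act R f ∘ₗ cone R a) (T := cone R (f a) ∘ₗ act R f) (fun l => by simp) z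

lemma faces_map (f : α → β) (l : List α) : faces R (l.map f) = act R f (faces R l) := by
  induction l with
  | nil => simp [faces]
  | cons a l ih => simp [faces, act_cone, ih]

lemma bd_act (f : α → β) (z : Chain R α) : bd (act R f z) = act R f (bd z) :=
  ext_single (S := bd ∘ₗ act R f) (T := act R f ∘ₗ bd) (fun l => by simp [faces_map]) z

lemma act_act {γ : Type*} (g : β → γ) (f : α → β) (z : Chain R α) :
    act R g (act R f z) = act R (g ∘ f) z :=
  ext_single (S := act R g ∘ₗ act R f) (T := act R (g ∘ f)) (fun l => by simp) z

lemma act_id (z : Chain R α) : act R id z = z :=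
  ext_single (S := act R id) (T := LinearMap.id) (fun l => by simp) z

lemma eq_of_mem_Sup {M : Type*} [AddCommGroup M] [Module R M] {P : List α → Prop}
    {S T : Chain R α →ₗ[R] M} (h : ∀ l, P l → S (Finsupp.single l 1) = T (Finsupp.single l 1))
    {z : Chain R α} (hz : z ∈ Sup R P) : S z = T z := by
  rw [Sup, Finsupp.supported_eq_span_single] at hz
  have : Set.EqOn S T (Submodule.span R ((fun i => Finsupp.single i (1 : R)) '' {l | P l})) :=
    LinearMap.eqOn_span' (by rintro _ ⟨l, hl, rfl⟩; exact h l hl)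
  exact this hz

lemma map_mem_of_mem_Sup {M : Type*} [AddCommGroup M] [Module R M] {P : List α → Prop}
    {S : Chain R α →ₗ[R] M} {N : Submodule R M} (h : ∀ l, P l → S (Finsupp.single l 1) ∈ N)
    {z : Chain R α} (hz : z ∈ Sup R P) : S z ∈ N := by
  rw [Sup, Finsupp.supported_eq_span_single] at hz
  have : Submodule.span R ((fun i => Finsupp.single i (1 : R)) '' {l | P l}) ≤ N.comap S :=
    Submodule.span_le.2 (by rintro _ ⟨l, hl, rfl⟩; exact h l hl)
  exact this hz

lemma single_mem_Sup {P : List α → Prop} {l : List α} (h : P l) :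
    Finsupp.single l (1 : R) ∈ Sup R P :=
  Finsupp.single_mem_supported R _ h

lemma Sup_mono {P Q : List α → Prop} (h : ∀ l, P l → Q l) {z : Chain R α} (hz : z ∈ Sup R P) :
    z ∈ Sup R Q :=
  Finsupp.supported_mono (fun _ hl => h _ hl) hz

lemma cone_mem {P Q : List α → Prop} {a : α} (h : ∀ l, P l → Q (a :: l)) {z : Chain R α}
    (hz : z ∈ Sup R P) : cone R a z ∈ Sup R Q :=
  map_mem_of_mem_Sup (fun l hl => by simpa using single_mem_Sup (h l hl)) hz

lemma act_mem {P : List α → Prop} {Q : List β → Prop} {f : α → β} (h : ∀ l, P l → Q (l.map f))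
    {z : Chain R α} (hz : z ∈ Sup R P) : act R f z ∈ Sup R Q :=
  map_mem_of_mem_Sup (fun l hl => by simpa using single_mem_Sup (h l hl)) hz

lemma act_congr {P : List α → Prop} {f g : α → β} (h : ∀ l, P l → l.map f = l.map g)
    {z : Chain R α} (hz : z ∈ Sup R P) : act R f z = act R g z :=
  eq_of_mem_Sup (fun l hl => by simp [h l hl]) hz

lemma ev_eq_zero {P : List α → Prop} {f : List α → R} (h : ∀ l, P l → f l = 0)
    {z : Chain R α} (hz : z ∈ Sup R P) : ev f z = 0 :=
  eq_of_mem_Sup (S := ev f) (T := 0) (fun l hl => by simp [h l hl]) hz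

lemma faces_mem (l : List α) :
    faces R l ∈ Sup R (fun f => f.Sublist l ∧ f.length + 1 = l.length) := by
  induction l with
  | nil => simp [faces]
  | cons a l ih =>
    refine Submodule.sub_mem _ (single_mem_Sup (by simp)) (cone_mem ?_ ih)
    rintro f ⟨h1, h2⟩
    exact ⟨h1.cons_cons a, by simp [h2]⟩

section Subdivision

variable [NormedAddCommGroup E] [NormedSpace ℝ E]

/-- The barycentre of a list of points. -/
def bary (l : List E) : E := (l.length : ℝ)⁻¹ • l.sum

/-- Barycentric subdivision of simplices of a given length. -/
def sdAux (R : Type*) [CommRing R] : ℕ → List E → Chain R E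
  | 0, l => Finsupp.single l 1
  | k + 1, l => cone R (bary l) (Finsupp.linearCombination R (sdAux R k) (faces R l))

/-- Barycentric subdivision. -/
def sd : Chain R E →ₗ[R] Chain R E :=
  Finsupp.linearCombination R (fun l => sdAux R l.length l)

@[simp] lemma sd_nil : sd (Finsupp.single ([] : List E) (1 : R)) = Finsupp.single [] 1 := by
  simp [sd, sdAux]

lemma sd_single {l : List E} (hl : l ≠ []) :
    sd (Finsupp.single l (1 : R)) = cone R (bary l) (sd (faces R l)) := by
  obtain ⟨k, hk⟩ : ∃ k, l.length = k + 1 :=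
    Nat.exists_eq_succ_of_ne_zero (by simpa using hl)
  simp only [sd, Finsupp.linearCombination_single, one_smul, hk, sdAux]
  congr 1
  refine eq_of_mem_Sup (fun f hf => ?_) (faces_mem l)
  have : f.length = k := by omega
  simp [this]

lemma bd_sd_single (k : ℕ) : ∀ l : List E, l.length = k →
    bd (sd (Finsupp.single l (1 : R))) = sd (faces R l) := by
  induction k with
  | zero =>
    intro l hl
    obtain rfl : l = [] := by simpa using hl
    simp [faces]
  | succ k ih =>
    intro l hl
    have h : bd (sd (faces R l)) = sd (bd (faces R l)) :=
      eq_of_mem_Sup (S := bd ∘ₗ sd) (T := sd ∘ₗ bd)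
        (fun f hf => by simpa using ih f (by omega)) (faces_mem l)
    rw [sd_single (by rintro rfl; simp at hl), bd_cone, h, bd_faces]
    simp

lemma bd_sd (z : Chain R E) : bd (sd z) = sd (bd z) :=
  ext_single (S := bd ∘ₗ sd) (T := sd ∘ₗ bd) (fun l => by simpa using bd_sd_single _ l rfl) z

lemma bary_eq_sum (l : List E) :
    bary l = ∑ i : Fin l.length, (l.length : ℝ)⁻¹ • l.get i := by
  rw [bary, ← Finset.smul_sum]
  congr 1
  conv_lhs => rw [← List.ofFn_get l, List.sum_ofFn]

lemma map_bary (f : E →ₗ[ℝ] E) (l : List E) : f (bary l) = bary (l.map f) := by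
  simp [bary, map_list_sum]

lemma sd_act (f : E →ₗ[ℝ] E) (z : Chain R E) : sd (act R f z) = act R f (sd z) := by
  refine ext_single (S := sd ∘ₗ act R f) (T := act R f ∘ₗ sd) (fun l => ?_) z
  generalize hk : l.length = k
  induction k generalizing l with
  | zero =>
    obtain rfl : l = [] := by simpa using hk
    simp
  | succ k ih =>
    have hl : l ≠ [] := by rintro rfl; simp at hk
    have h : sd (act R f (faces R l)) = act R f (sd (faces R l)) :=
      eq_of_mem_Sup (S := sd ∘ₗ act R f) (T := act R f ∘ₗ sd)
        (fun g hg => ih g (by omega)) (faces_mem l)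
    simp only [LinearMap.comp_apply, act_single]
    rw [sd_single hl, sd_single (by simpa using hl), faces_map, h, act_cone, map_bary]

/-- The simplex spanned by a list of points. -/
abbrev hull (l : List E) : Set E := convexHull ℝ {x | x ∈ l}

lemma hull_mono {l l' : List E} (h : ∀ x ∈ l', x ∈ hull l) : hull l' ⊆ hull l :=
  convexHull_min h (convex_convexHull ℝ _)

lemma bary_mem_hull {l : List E} (hl : l ≠ []) : bary l ∈ hull l := by
  have h0 : (l.length : ℝ) ≠ 0 := by simpa using hl
  rw [bary_eq_sum]
  refine (convex_convexHull ℝ _).sum_mem (fun _ _ => by positivity) ?_ fun i _ =>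
    subset_convexHull ℝ _ (List.get_mem l i)
  simp [h0]

lemma dist_bary_le {l : List E} (h4 : l.length ≤ 4) {D : ℝ}
    (hD : ∀ x ∈ l, ∀ y ∈ l, dist x y ≤ D) {x : E} (hx : x ∈ l) :
    dist (bary l) x ≤ 3 / 4 * D := by
  have hD0 : 0 ≤ D := by simpa using hD x hx x hx
  obtain ⟨i₀, rfl⟩ := List.get_of_mem hx
  have hpos : 0 < (l.length : ℝ) := by
    have := i₀.pos
    exact_mod_cast this
  have hsub : bary l - l.get i₀ = ∑ i : Fin l.length, (l.length : ℝ)⁻¹ • (l.get i - l.get i₀) := by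
    simp only [smul_sub, Finset.sum_sub_distrib, ← bary_eq_sum]
    simp [← Nat.cast_smul_eq_nsmul ℝ, smul_smul, hpos.ne']
  have hle : ∀ i ∈ Finset.univ.erase i₀,
      ‖(l.length : ℝ)⁻¹ • (l.get i - l.get i₀)‖ ≤ (l.length : ℝ)⁻¹ * D := by
    intro i _
    rw [norm_smul, Real.norm_of_nonneg (by positivity), ← dist_eq_norm]
    gcongr
    exact hD _ (List.get_mem l i) _ (List.get_mem l i₀)
  have h1 : (l.length : ℝ) ≤ 4 := by exact_mod_cast h4
  rw [dist_eq_norm, hsub, ← Finset.add_sum_erase _ _ (Finset.mem_univ i₀)]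
  simp only [sub_self, smul_zero, zero_add]
  refine (norm_sum_le_of_le _ hle).trans ?_
  simp only [Finset.sum_const, nsmul_eq_mul, Finset.card_erase_of_mem (Finset.mem_univ i₀),
    Finset.card_univ, Fintype.card_fin, Nat.cast_pred i₀.pos]
  rw [← mul_assoc]
  gcongr
  rw [← div_eq_mul_inv, div_le_iff₀ hpos]
  linarith

lemma sd_single_mem (l : List E) :
    sd (Finsupp.single l (1 : R)) ∈
      Sup R (fun l' => l'.length = l.length ∧ ∀ x ∈ l', x ∈ hull l) := by
  generalize hk : l.length = k
  induction k generalizing l with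
  | zero =>
    obtain rfl : l = [] := by simpa using hk
    simpa using single_mem_Sup (by simp)
  | succ k ih =>
    have hl : l ≠ [] := by rintro rfl; simp at hk
    rw [sd_single hl]
    refine cone_mem (P := fun l' => l'.length = k ∧ ∀ x ∈ l', x ∈ hull l) ?_
      (map_mem_of_mem_Sup ?_ (faces_mem l))
    · rintro l' ⟨h1, h2⟩
      refine ⟨by simp [h1], ?_⟩
      simpa using ⟨bary_mem_hull hl, h2⟩
    · rintro f ⟨hf1, hf2⟩
      refine Sup_mono ?_ (ih f (by omega))
      rintro l' ⟨h1, h2⟩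
      exact ⟨h1, fun x hx =>
        hull_mono (fun y hy => subset_convexHull ℝ _ (hf1.subset hy)) (h2 x hx)⟩

lemma sd_single_mem_dist {D : ℝ} (hD0 : 0 ≤ D) (l : List E) (h4 : l.length ≤ 4)
    (hD : ∀ x ∈ l, ∀ y ∈ l, dist x y ≤ D) :
    sd (Finsupp.single l (1 : R)) ∈ Sup R (fun l' => l'.length = l.length ∧ (∀ x ∈ l', x ∈ hull l) ∧
      ∀ x ∈ l', ∀ y ∈ l', dist x y ≤ 3 / 4 * D) := by
  generalize hk : l.length = k
  induction k generalizing l with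
  | zero =>
    obtain rfl : l = [] := by simpa using hk
    simpa using single_mem_Sup (by simp)
  | succ k ih =>
    have hl : l ≠ [] := by rintro rfl; simp at hk
    rw [sd_single hl]
    refine cone_mem (P := fun l' => l'.length = k ∧ (∀ x ∈ l', x ∈ hull l) ∧
      ∀ x ∈ l', ∀ y ∈ l', dist x y ≤ 3 / 4 * D) ?_ (map_mem_of_mem_Sup ?_ (faces_mem l))
    · rintro l' ⟨h1, h2, h3⟩
      have hb : ∀ x ∈ hull l, dist x (bary l) ≤ 3 / 4 * D := by
        have : hull l ⊆ Metric.closedBall (bary l) (3 / 4 * D) :=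
          convexHull_min (fun x hx => by
            rw [Metric.mem_closedBall, dist_comm]; exact dist_bary_le h4 hD hx)
            (convex_closedBall _ _)
        exact fun x hx => this hx
      refine ⟨by simp [h1], by simpa using ⟨bary_mem_hull hl, h2⟩, ?_⟩
      intro x hx y hy
      rcases List.mem_cons.1 hx with rfl | hx <;> rcases List.mem_cons.1 hy with rfl | hy
      · simpa using by positivity
      · rw [dist_comm]; exact hb _ (h2 _ hy)
      · exact hb _ (h2 _ hx)
      · exact h3 x hx y hy
    · rintro f ⟨hf1, hf2⟩
      refine Sup_mono ?_ (ih f (by omega) (fun x hx y hy => hD x (hf1.subset hx) y (hf1.subset hy))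
        (by omega))
      rintro l' ⟨h1, h2, h3⟩
      exact ⟨h1, fun x hx =>
        hull_mono (fun y hy => subset_convexHull ℝ _ (hf1.subset hy)) (h2 x hx),
        h3⟩

end Subdivision
section Fine

variable [NormedAddCommGroup E] [NormedSpace ℝ E]

/-- Simplices with a given number of vertices which miss the origin. -/
def Good (k : ℕ) (l : List E) : Prop := l.length = k ∧ (0 : E) ∉ hull l

lemma Good.ne_zero {k : ℕ} {l : List E} (h : Good k l) {x : E} (hx : x ∈ l) : x ≠ 0 := by
  rintro rfl
  exact h.2 (subset_convexHull ℝ _ hx)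

lemma sd_good {k : ℕ} {z : Chain R E} (hz : z ∈ Sup R (Good k)) : sd z ∈ Sup R (Good k) :=
  map_mem_of_mem_Sup (fun l hl => Sup_mono
    (fun _ h => ⟨h.1.trans hl.1, fun h0 => hl.2 (hull_mono h.2 h0)⟩) (sd_single_mem l)) hz

lemma act_good {k : ℕ} (f : E →ₗ[ℝ] E) (hf : Function.Injective f) {z : Chain R E}
    (hz : z ∈ Sup R (Good k)) : act R f z ∈ Sup R (Good k) := by
  refine act_mem ?_ hz
  rintro l ⟨h1, h2⟩
  refine ⟨by simpa using h1, fun h0 => h2 ?_⟩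
  have : {x | x ∈ l.map f} = f '' {x | x ∈ l} := by
    ext; simp
  rw [hull, this, ← LinearMap.image_convexHull] at h0
  obtain ⟨y, hy, hy0⟩ := h0
  obtain rfl : y = 0 := hf (hy0.trans (map_zero f).symm)
  exact hy

lemma exists_bd_eq [FiniteDimensional ℝ E] {k : ℕ} (hk : k < Module.finrank ℝ E)
    {z : Chain R E} (hz : z ∈ Sup R (Good k)) (h0 : bd z = 0) :
    ∃ w ∈ Sup R (Good (k + 1)), bd w = z := by
  classical
  obtain ⟨p, hp⟩ : ∃ p : E, ∀ l ∈ z.support, p ∉ Submodule.span ℝ {x | x ∈ l} := by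
    by_contra! hcon
    refine Subspace.biUnion_ne_univ_of_top_notMem (k := ℝ)
      (s := z.support.image fun l => Submodule.span ℝ {x : E | x ∈ l}) ?_ ?_
    · intro htop
      obtain ⟨l, hl, hl'⟩ := Finset.mem_image.1 htop
      have h1 := finrank_span_finset_le_card (R := ℝ) (M := E) l.toFinset
      have h2 : ((l.toFinset : Finset E) : Set E) = {x | x ∈ l} := by
        ext; simp
      rw [Set.finrank, h2, hl', finrank_top] at h1
      have h3 := l.toFinset_card_le
      have h4 : l.length = k := (hz hl).1
      omega
    · refine Set.eq_univ_of_forall fun p => ?_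
      obtain ⟨l, hl, hpl⟩ := hcon p
      exact Set.mem_biUnion (Finset.mem_image_of_mem _ hl) hpl
  refine ⟨cone R p z, ?_, by simp [bd_cone, h0]⟩
  have hz' : z ∈ Sup R (fun l => Good k l ∧ p ∉ Submodule.span ℝ {x | x ∈ l}) := by
    rw [Finsupp.mem_supported] at hz ⊢
    exact fun l hl => ⟨hz hl, hp l hl⟩
  refine cone_mem ?_ hz'
  rintro l ⟨⟨h1, h2⟩, h3⟩
  refine ⟨by simp [h1], fun hmem => ?_⟩
  have hset : {x | x ∈ p :: l} = insert p {x | x ∈ l} := by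
    ext; simp
  rcases l with _ | ⟨a, l⟩
  · rw [hull, hset] at hmem
    simp at h3 hmem
    exact h3 hmem.symm
  rw [hull, hset, convexHull_insert ⟨a, by simp⟩, mem_convexJoin] at hmem
  obtain ⟨p', hp', y, hy, s, t, hs, ht, hst, h⟩ := hmem
  obtain rfl : p' = p := hp'
  rcases hs.eq_or_lt with rfl | hs
  · obtain rfl : t = 1 := by linarith
    simp at h
    exact h2 (h ▸ hy)
  · apply h3
    have hy' : y ∈ Submodule.span ℝ {x | x ∈ a :: l} :=
      convexHull_min Submodule.subset_span (Submodule.convex _) hy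
    have : p' = -(s⁻¹ * t) • y := by
      have : s • p' = - (t • y) := eq_neg_of_add_eq_zero_left h
      rw [← inv_smul_smul₀ hs.ne' p', this, smul_neg, smul_smul, neg_smul]
    rw [this]
    exact Submodule.smul_mem _ _ hy'

/-- If the labels occurring near any nonzero point are at most three, then sufficiently fine
subdivisions have no simplex with four distinct labels. -/
lemma exists_fine {V : Type*} {c : E → V}
    (hc : ∀ x : E, x ≠ 0 → ∃ U ∈ nhds x, ∃ S : Finset V, S.card ≤ 3 ∧ ∀ y ∈ U, y ≠ 0 → c y ∈ S)
    {e : Chain R E} (he : e ∈ Sup R (Good 4)) :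
    ∃ m : ℕ, act R c ((sd ^ m : Chain R E →ₗ[R] Chain R E) e) ∈
      Sup R (fun l => l.length = 4 ∧ ¬ l.Nodup) := by
  classical
  set K : Set E := ⋃ l ∈ e.support, hull l with hK
  have hKc : IsCompact K :=
    e.support.isCompact_biUnion fun l _ => (List.finite_toSet l).isCompact_convexHull ℝ
  have hK0 : ∀ x ∈ K, x ≠ 0 := by
    rintro x hx rfl
    simp only [hK, Set.mem_iUnion] at hx
    obtain ⟨l, hl, hx⟩ := hx
    exact (he hl).2 hx
  choose! U hU S hS hUS using hc
  obtain ⟨δ, hδ, hball⟩ := lebesgue_number_lemma_of_metric hKc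
    (c := fun x : K => interior (U x)) (fun x => isOpen_interior) (fun x hx =>
      Set.mem_iUnion.2 ⟨⟨x, hx⟩, mem_interior_iff_mem_nhds.2 (hU x (hK0 x hx))⟩)
  obtain ⟨D, hD0, hD⟩ : ∃ D : ℝ, 0 ≤ D ∧ ∀ l ∈ e.support, ∀ x ∈ l, ∀ y ∈ l, dist x y ≤ D := by
    have hb := hKc.isBounded
    refine ⟨Metric.diam K, Metric.diam_nonneg, fun l hl x hx y hy => ?_⟩
    exact Metric.dist_le_diam_of_mem hb
      (Set.mem_biUnion hl (subset_convexHull ℝ _ hx))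
      (Set.mem_biUnion hl (subset_convexHull ℝ _ hy))
  have hsd : ∀ m : ℕ, (sd ^ m : Chain R E →ₗ[R] Chain R E) e ∈ Sup R (fun l' => l'.length = 4 ∧
      (∀ x ∈ l', x ∈ K) ∧ (∃ l ∈ e.support, ∀ x ∈ l', x ∈ hull l) ∧
      ∀ x ∈ l', ∀ y ∈ l', dist x y ≤ (3 / 4) ^ m * D) := by
    intro m
    induction m with
    | zero =>
      rw [Finsupp.mem_supported]
      intro l hl
      have h : ∀ x ∈ l, x ∈ hull l := fun x hx => subset_convexHull ℝ _ hx
      exact ⟨(he hl).1, fun x hx => Set.mem_biUnion hl (h x hx), ⟨l, hl, h⟩, by simpa using hD l hl⟩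
    | succ m ih =>
      rw [show (sd ^ (m + 1) : Chain R E →ₗ[R] Chain R E) = sd * sd ^ m from pow_succ' _ _,
        Module.End.mul_apply]
      refine map_mem_of_mem_Sup ?_ ih
      rintro l' ⟨h1, -, ⟨l, hl, h3⟩, h4⟩
      refine Sup_mono ?_ (sd_single_mem_dist (by positivity) l' h1.le h4)
      rintro l'' ⟨g1, g2, g3⟩
      have g : ∀ x ∈ l'', x ∈ hull l := fun x hx => hull_mono h3 (g2 x hx)
      refine ⟨g1.trans h1, fun x hx => Set.mem_biUnion hl (g x hx), ⟨l, hl, g⟩, ?_⟩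
      intro x hx y hy
      refine (g3 x hx y hy).trans_eq (by ring)
  obtain ⟨m, hm⟩ : ∃ m : ℕ, (3 / 4 : ℝ) ^ m * D < δ := by
    have : Filter.Tendsto (fun m : ℕ => (3 / 4 : ℝ) ^ m * D) Filter.atTop (nhds (0 * D)) :=
      (tendsto_pow_atTop_nhds_zero_of_lt_one (by norm_num) (by norm_num)).mul_const D
    rw [zero_mul] at this
    exact (this.eventually_lt_const hδ).exists
  refine ⟨m, act_mem ?_ (hsd m)⟩
  rintro l ⟨h1, h2, -, h4⟩
  refine ⟨by simpa using h1, fun hnd => ?_⟩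
  obtain ⟨x, hx⟩ : ∃ x, x ∈ l := List.exists_mem_of_length_pos (by omega)
  obtain ⟨y, hy⟩ := hball x (h2 x hx)
  have hsub : (l.map c).toFinset ⊆ S y := by
    intro v hv
    obtain ⟨x', hx', rfl⟩ : ∃ x' ∈ l, c x' = v := by simpa using hv
    refine hUS y (hK0 _ y.2) x' (interior_subset (hy ?_)) (hK0 _ (h2 x' hx'))
    exact (h4 x' hx' x hx).trans_lt hm
  have := (Finset.card_le_card hsub).trans (hS y (hK0 _ y.2))
  rw [List.toFinset_card_of_nodup hnd] at this
  simp [h1] at this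

end Fine

section Labels

variable [NormedAddCommGroup E] [NormedSpace ℝ E]

lemma bd_sd_pow (m : ℕ) (z : Chain R E) :
    bd ((sd ^ m : Chain R E →ₗ[R] Chain R E) z) = (sd ^ m : Chain R E →ₗ[R] Chain R E) (bd z) := by
  have h : Commute (bd : Chain R E →ₗ[R] Chain R E) sd := LinearMap.ext fun z => bd_sd z
  exact LinearMap.congr_fun (h.pow_right m).eq z

lemma act_sd_pow (f : E →ₗ[ℝ] E) (m : ℕ) (z : Chain R E) :
    (sd ^ m : Chain R E →ₗ[R] Chain R E) (act R f z) =
      act R f ((sd ^ m : Chain R E →ₗ[R] Chain R E) z) := by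
  have h : Commute (act R f : Chain R E →ₗ[R] Chain R E) sd :=
    LinearMap.ext fun z => (sd_act f z).symm
  exact (LinearMap.congr_fun (h.pow_right m).eq z).symm

lemma sd_pow_good (m : ℕ) {k : ℕ} {z : Chain R E} (hz : z ∈ Sup R (Good k)) :
    (sd ^ m : Chain R E →ₗ[R] Chain R E) z ∈ Sup R (Good k) := by
  induction m with
  | zero => simpa using hz
  | succ m ih =>
    rw [show (sd ^ (m + 1) : Chain R E →ₗ[R] Chain R E) = sd * sd ^ m from pow_succ' _ _]
    exact sd_good ih

lemma sd_pow_nil (m : ℕ) : (sd ^ m : Chain R E →ₗ[R] Chain R E) (Finsupp.single [] 1) =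
    Finsupp.single [] 1 := by
  induction m with
  | zero => simp
  | succ m ih =>
    rw [show (sd ^ (m + 1) : Chain R E →ₗ[R] Chain R E) = sd * sd ^ m from pow_succ' _ _,
      Module.End.mul_apply, ih, sd_nil]

/-- The labels of the vertices of the `m`-fold subdivision. -/
def labels {V : Type*} (R : Type*) [CommRing R] (c : E → V) (m : ℕ) : Chain R E →ₗ[R] Chain R V :=
  act R c ∘ₗ (sd ^ m : Chain R E →ₗ[R] Chain R E)

variable {V : Type*} {c : E → V} {m : ℕ}

lemma bd_labels (z : Chain R E) : bd (labels R c m z) = labels R c m (bd z) := by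
  simp [labels, bd_act, bd_sd_pow]

lemma labels_nil : labels R c m (Finsupp.single [] 1) = Finsupp.single [] 1 := by
  simp [labels, sd_pow_nil]

lemma labels_mem {k : ℕ} {z : Chain R E} (hz : z ∈ Sup R (Good k)) :
    labels R c m z ∈ Sup R (fun l : List V => l.length = k) :=
  act_mem (fun l hl => by simpa using hl.1) (sd_pow_good m hz)

lemma labels_act {f : E →ₗ[ℝ] E} {ρ : V → V} (hf : ∀ x, x ≠ 0 → c (f x) = ρ (c x)) {k : ℕ}
    {z : Chain R E} (hz : z ∈ Sup R (Good k)) :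
    labels R c m (act R f z) = act R ρ (labels R c m z) := by
  simp only [labels, LinearMap.comp_apply, act_sd_pow, act_act]
  refine act_congr (fun l hl => ?_) (sd_pow_good m hz)
  exact List.map_congr_left fun x hx => hf x (hl.ne_zero hx)

lemma single_good {x : E} (hx : x ≠ 0) : Finsupp.single [x] (1 : R) ∈ Sup R (Good 1) := by
  refine single_mem_Sup ⟨rfl, ?_⟩
  simpa [hull] using hx.symm

lemma exists_cyclic_chains (hE : Module.finrank ℝ E = 4) (f : E →ₗ[ℝ] E)
    (hf : ∀ x, f (f (f (f (f x)))) = x) :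
    ∃ a ∈ Sup R (Good (E := E) 1), ∃ b ∈ Sup R (Good (E := E) 2),
    ∃ c ∈ Sup R (Good (E := E) 3), ∃ e ∈ Sup R (Good (E := E) 4),
      bd a = Finsupp.single [] 1 ∧ bd b = act R f a - a ∧
      bd c = b + act R f b + act R f (act R f b) + act R f (act R f (act R f b)) +
        act R f (act R f (act R f (act R f b))) ∧
      bd e = act R f c - c := by
  have hinj : Function.Injective f := fun x y h => by rw [← hf x, h, hf y]
  have : FiniteDimensional ℝ E := .of_finrank_pos (by omega)
  have : Nontrivial E := Module.nontrivial_of_finrank_pos (R := ℝ) (by omega)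
  obtain ⟨x, hx⟩ := exists_ne (0 : E)
  have hF {k : ℕ} {z : Chain R E} (hz : z ∈ Sup R (Good k)) : act R f z ∈ Sup R (Good k) :=
    act_good f hinj hz
  have hF5 (z : Chain R E) : act R f (act R f (act R f (act R f (act R f z)))) = z := by
    simp only [act_act]
    convert act_id z
    ext x
    exact hf x
  have ha := single_good (R := R) hx
  have ha1 : bd (Finsupp.single [x] (1 : R)) = Finsupp.single [] 1 := by simp [faces]
  obtain ⟨b, hb, hb1⟩ := exists_bd_eq (by omega) (sub_mem (hF ha) ha)
    (by rw [map_sub, bd_act, ha1]; simp)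
  obtain ⟨c, hc, hc1⟩ := exists_bd_eq (by omega) (add_mem (add_mem (add_mem (add_mem hb (hF hb))
    (hF (hF hb))) (hF (hF (hF hb)))) (hF (hF (hF (hF hb)))))
    (by simp only [map_add, bd_act, hb1, map_sub, hF5]; abel)
  obtain ⟨e, he, he1⟩ := exists_bd_eq (by omega) (sub_mem (hF hc) hc)
    (by simp only [map_add, bd_act, hc1, map_sub, hF5]; abel)
  exact ⟨_, ha, b, hb, c, hc, e, he, ha1, hb1, hc1, he1⟩

lemma exists_quaternion_chains (hE : Module.finrank ℝ E = 4) (f g : E →ₗ[ℝ] E)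
    (hfi : Function.Injective f) (hgi : Function.Injective g)
    (hf : ∀ x, f (f (f (f x))) = g (g x)) (hfg : ∀ x, f (g (f x)) = g x) :
    ∃ a ∈ Sup (ZMod 2) (Good (E := E) 1), ∃ b ∈ Sup (ZMod 2) (Good (E := E) 2),
    ∃ b' ∈ Sup (ZMod 2) (Good (E := E) 2), ∃ c ∈ Sup (ZMod 2) (Good (E := E) 3),
    ∃ c' ∈ Sup (ZMod 2) (Good (E := E) 3), ∃ e ∈ Sup (ZMod 2) (Good (E := E) 4),
      bd a = Finsupp.single [] 1 ∧ bd b = act (ZMod 2) f a + a ∧ bd b' = act (ZMod 2) g a + a ∧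
      bd c = b + act (ZMod 2) f b + act (ZMod 2) f (act (ZMod 2) f b) +
        act (ZMod 2) f (act (ZMod 2) f (act (ZMod 2) f b)) + act (ZMod 2) g b' + b' ∧
      bd c' = act (ZMod 2) f (act (ZMod 2) g b) + b + act (ZMod 2) f b' + b' ∧
      bd e = act (ZMod 2) f c + c + act (ZMod 2) f (act (ZMod 2) g c') + c' := by
  have : FiniteDimensional ℝ E := .of_finrank_pos (by omega)
  have : Nontrivial E := Module.nontrivial_of_finrank_pos (R := ℝ) (by omega)
  obtain ⟨x, hx⟩ := exists_ne (0 : E)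
  set F := act (ZMod 2) f with hFdef
  set G := act (ZMod 2) g with hGdef
  have hF {k : ℕ} {z : Chain (ZMod 2) E} (hz : z ∈ Sup (ZMod 2) (Good k)) :
    F z ∈ Sup (ZMod 2) (Good k) := act_good f hfi hz
  have hG {k : ℕ} {z : Chain (ZMod 2) E} (hz : z ∈ Sup (ZMod 2) (Good k)) :
    G z ∈ Sup (ZMod 2) (Good k) := act_good g hgi hz
  have hbF (z) : bd (F z) = F (bd z) := bd_act _ _
  have hbG (z) : bd (G z) = G (bd z) := bd_act _ _
  have hF4 (z) : F (F (F (F z))) = G (G z) := by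
    simp only [F, G, act_act]
    exact congrArg (fun φ => act (ZMod 2) φ z) (funext hf)
  have hFG (z) : F (G (F z)) = G z := by
    simp only [F, G, act_act]
    exact congrArg (fun φ => act (ZMod 2) φ z) (funext hfg)
  have h2 (z : Chain (ZMod 2) E) : z + z = 0 := by
    rw [← two_smul (ZMod 2), show (2 : ZMod 2) = 0 from rfl, zero_smul]
  have ha := single_good (R := ZMod 2) hx
  have ha1 : bd (Finsupp.single [x] (1 : ZMod 2)) = Finsupp.single [] 1 := by simp [faces]
  have hn (f : E → E) : act (ZMod 2) f (Finsupp.single [] 1) = Finsupp.single [] 1 := by simp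
  obtain ⟨b, hb, hb1⟩ := exists_bd_eq (by omega) (add_mem (hF ha) ha)
    (by rw [map_add, hbF, ha1, hFdef, hn, h2])
  obtain ⟨b', hb', hb1'⟩ := exists_bd_eq (by omega) (add_mem (hG ha) ha)
    (by rw [map_add, hbG, ha1, hGdef, hn, h2])
  generalize Finsupp.single [x] (1 : ZMod 2) = a at *
  obtain ⟨c, hc, hc1⟩ := exists_bd_eq (by omega) (add_mem (add_mem (add_mem (add_mem (add_mem hb
    (hF hb)) (hF (hF hb))) (hF (hF (hF hb)))) (hG hb')) hb')
    (by
      simp only [map_add, hbF, hbG, hb1, hb1', hF4]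
      linear_combination (norm := abel) h2 (F a) + h2 a + h2 (F (F a)) + h2 (F (F (F a))) +
        h2 (G a) + h2 (G (G a)))
  obtain ⟨c', hc', hc1'⟩ := exists_bd_eq (by omega) (add_mem (add_mem (add_mem (hF (hG hb)) hb)
    (hF hb')) hb')
    (by
      simp only [map_add, hbF, hbG, hb1, hb1', hFG]
      linear_combination (norm := abel) h2 (F a) + h2 a + h2 (F (G a)) + h2 (G a))
  obtain ⟨e, he, he1⟩ := exists_bd_eq (by omega) (add_mem (add_mem (add_mem (hF hc) hc)
    (hF (hG hc'))) hc')
    (by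
      simp only [map_add, hbF, hbG, hc1, hc1', hFG, hF4]
      linear_combination (norm := abel) h2 (F b) + h2 b + h2 (F (F b)) + h2 (F (F (F b))) +
        h2 (G (G b)) + h2 (F (G b)) + h2 (F (G b')) + h2 (F b') + h2 (G b') + h2 b')
  exact ⟨_, ha, b, hb, b', hb', c, hc, c', hc', e, he, ha1, hb1, hb1', hc1, hc1', he1⟩

end Labels

section Cochains

/-- The cochain on vertices given by a function. -/
def cochain₁ {V : Type*} (g : V → R) : List V → R
  | [a] => g a
  | _ => 0

/-- The cochain on edges given by a function. -/
def cochain₂ {V : Type*} (g : V → V → R) : List V → R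
  | [a, b] => g a b
  | _ => 0

/-- The cochain on triangles given by a function. -/
def cochain₃ {V : Type*} (g : V → V → V → R) : List V → R
  | [a, b, c] => g a b c
  | _ => 0

/-- The cochain on tetrahedra given by a function. -/
def cochain₄ {V : Type*} (g : V → V → V → V → R) : List V → R
  | [a, b, c, d] => g a b c d
  | _ => 0

/-- The augmentation. -/
def cochain₀ {V : Type*} : List V → R
  | [] => 1
  | _ => 0

/-- The Vandermonde determinant of four variables. -/
def vdm (a b c d : R) : R := (b - a) * (c - a) * (d - a) * (c - b) * (d - b) * (d - c)

lemma vdm_eq_zero {a b c d : R} (h : ¬ [a, b, c, d].Nodup) : vdm a b c d = 0 := by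
  have : a = b ∨ a = c ∨ a = d ∨ b = c ∨ b = d ∨ c = d := by
    by_contra! hne
    exact h (by simp [hne])
  rcases this with rfl | rfl | rfl | rfl | rfl | rfl <;> simp [vdm]

lemma cyclic_cochain_contradiction {a b c e : Chain (ZMod 5) (ZMod 5)}
    (ha : a ∈ Sup (ZMod 5) (fun l : List (ZMod 5) => l.length = 1))
    (hb : b ∈ Sup (ZMod 5) (fun l : List (ZMod 5) => l.length = 2))
    (hc : c ∈ Sup (ZMod 5) (fun l : List (ZMod 5) => l.length = 3))
    (he : e ∈ Sup (ZMod 5) (fun l : List (ZMod 5) => l.length = 4 ∧ ¬ l.Nodup))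
    {ρ : Chain (ZMod 5) (ZMod 5) →ₗ[ZMod 5] Chain (ZMod 5) (ZMod 5)} (hρ : ρ = act (ZMod 5) (· + 3))
    (ha' : bd a = Finsupp.single [] 1) (hb' : bd b = ρ a - a)
    (hc' : bd c = b + ρ b + ρ (ρ b) + ρ (ρ (ρ b)) + ρ (ρ (ρ (ρ b))))
    (he' : bd e = ρ c - c) : False := by
  let w : List (ZMod 5) → ZMod 5 := cochain₃ (vdm 0)
  let η : ZMod 5 → ZMod 5 → ZMod 5 := fun a b => vdm 0 3 (a + 3) (b + 3)
  let ζ : ZMod 5 → ZMod 5 := fun a =>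
    η 0 a + η 3 (a + 3) + η 6 (a + 6) + η 9 (a + 9) + η 12 (a + 12)
  have h3 : ev w (bd e) = ev (cochain₄ vdm) e :=
    eq_of_mem_Sup (S := ev w ∘ₗ bd)
      (fun l hl => by
        match l, hl.1 with
        | [a, b, c, d], _ => simp [faces, w, cochain₃, cochain₄, vdm]; ring) he
  have h3' : ev (cochain₄ vdm) e = 0 := ev_eq_zero (fun l hl => by
    match l, hl.1 with
    | [a, b, c, d], _ => exact vdm_eq_zero hl.2) he
  have h2 : ev (cochain₂ η) (bd c) = ev w (ρ c) - ev w c :=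
    eq_of_mem_Sup (S := ev (cochain₂ η) ∘ₗ bd) (T := ev w ∘ₗ ρ - ev w)
      (fun l hl => by
        match l, hl with
        | [a, b, c], _ => simp [faces, w, hρ, η, cochain₃, cochain₂, vdm]; ring) hc
  have h1 : ev (cochain₁ ζ) (bd b) = ev (cochain₂ η) (bd c) := by
    rw [hc']
    exact eq_of_mem_Sup (S := ev (cochain₁ ζ) ∘ₗ bd) (T := ev (cochain₂ η) ∘ₗ
      (LinearMap.id + ρ + ρ ∘ₗ ρ + ρ ∘ₗ ρ ∘ₗ ρ + ρ ∘ₗ ρ ∘ₗ ρ ∘ₗ ρ))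
      (fun l hl => by
        match l, hl with
        | [a, b], _ =>
          simp [faces, hρ, ζ, η, cochain₁, cochain₂, vdm]
          revert a b
          decide) hb
  have h0 : ev cochain₀ (bd a) = ev (cochain₁ ζ) (ρ a) - ev (cochain₁ ζ) a :=
    eq_of_mem_Sup (S := ev cochain₀ ∘ₗ bd) (T := ev (cochain₁ ζ) ∘ₗ ρ - ev (cochain₁ ζ))
      (fun l hl => by
        match l, hl with
        | [a], _ =>
          simp [faces, hρ, ζ, η, cochain₀, cochain₁, vdm]
          revert a
          decide) ha
  rw [he', map_sub] at h3
  rw [hb', map_sub] at h1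
  rw [← h0, h2, h3, h3', ha'] at h1
  simp [cochain₀] at h1
  exact absurd h1 (by decide)

lemma dihedral_cochain_contradiction {a b b' c c' e : Chain (ZMod 2) (Fin 4)}
    (ha : a ∈ Sup (ZMod 2) (fun l : List (Fin 4) => l.length = 1))
    (hb : b ∈ Sup (ZMod 2) (fun l : List (Fin 4) => l.length = 2))
    (hb' : b' ∈ Sup (ZMod 2) (fun l : List (Fin 4) => l.length = 2))
    (hc : c ∈ Sup (ZMod 2) (fun l : List (Fin 4) => l.length = 3))
    (hc' : c' ∈ Sup (ZMod 2) (fun l : List (Fin 4) => l.length = 3))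
    (he : e ∈ Sup (ZMod 2) (fun l : List (Fin 4) => l.length = 4 ∧ ¬ l.Nodup))
    {X Y : Chain (ZMod 2) (Fin 4) →ₗ[ZMod 2] Chain (ZMod 2) (Fin 4)}
    (hX : X = act (ZMod 2) (· - 1)) (hY : Y = act (ZMod 2) Fin.rev)
    (hda : bd a = Finsupp.single [] 1) (hdb : bd b = X a + a) (hdb' : bd b' = Y a + a)
    (hdc : bd c = b + X b + X (X b) + X (X (X b)) + Y b' + b')
    (hdc' : bd c' = X (Y b) + b + X b' + b')
    (hde : bd e = X c + c + X (Y c') + c') : False := by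
  let w : Fin 4 → Fin 4 → Fin 4 → ZMod 2 := fun a b c => if [0, a, b, c].Nodup then 1 else 0
  let η : Fin 4 → Fin 4 → ZMod 2 := fun a b => if [0, 1, a, b].Nodup then 1 else 0
  let η' : Fin 4 → Fin 4 → ZMod 2 := fun a b => if [0, 2, a, b].Nodup then 1 else 0
  let ζ : Fin 4 → ZMod 2 := ![0, 1, 0, 1]
  let ζ' : Fin 4 → ZMod 2 := ![0, 1, 1, 0]
  have h3 : ev (cochain₃ w) (bd e) = 0 :=
    eq_of_mem_Sup (S := ev (cochain₃ w) ∘ₗ bd) (T := 0)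
      (fun l hl => by
        match l, hl.1, hl.2 with
        | [a, b, c, d], _, hn =>
          simp only [faces, map_sub, map_zero, cone_single, ev_single, cochain₃, bd_single,
            LinearMap.comp_apply, LinearMap.zero_apply]
          clear * - hn
          revert a b c d
          decide) he
  have h2 : ev (cochain₂ η) (bd c) = ev (cochain₃ w) (X c) + ev (cochain₃ w) c :=
    eq_of_mem_Sup (S := ev (cochain₂ η) ∘ₗ bd) (T := ev (cochain₃ w) ∘ₗ X + ev (cochain₃ w))
      (fun l hl => by
        match l, hl with
        | [a, b, c], _ =>
          simp only [faces, map_sub, map_zero, cone_single, ev_single, cochain₃, cochain₂,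
            bd_single, LinearMap.comp_apply, LinearMap.add_apply, hX, act_single, List.map]
          clear * -
          revert a b c
          decide) hc
  have h2' : ev (cochain₂ η') (bd c') = ev (cochain₃ w) (X (Y c')) + ev (cochain₃ w) c' :=
    eq_of_mem_Sup (S := ev (cochain₂ η') ∘ₗ bd)
      (T := ev (cochain₃ w) ∘ₗ X ∘ₗ Y + ev (cochain₃ w))
      (fun l hl => by
        match l, hl with
        | [a, b, c], _ =>
          simp only [faces, map_sub, map_zero, cone_single, ev_single, cochain₃, cochain₂,
            bd_single, LinearMap.comp_apply, LinearMap.add_apply, hX, hY, act_single, List.map]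
          clear * -
          revert a b c
          decide) hc'
  have h1 : ev (cochain₁ ζ) (bd b) =
      ev (cochain₂ η) (b + X b + X (X b) + X (X (X b))) + ev (cochain₂ η') (X (Y b) + b) :=
    eq_of_mem_Sup (S := ev (cochain₁ ζ) ∘ₗ bd)
      (T := ev (cochain₂ η) ∘ₗ (LinearMap.id + X + X ∘ₗ X + X ∘ₗ X ∘ₗ X) +
        ev (cochain₂ η') ∘ₗ (X ∘ₗ Y + LinearMap.id))
      (fun l hl => by
        match l, hl with
        | [a, b], _ =>
          simp only [faces, map_sub, map_add, map_zero, cone_single, ev_single, cochain₁, cochain₂,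
            bd_single, LinearMap.comp_apply, LinearMap.add_apply, LinearMap.id_apply, hX, hY,
            act_single, List.map]
          clear * -
          revert a b
          decide) hb
  have h1' : ev (cochain₁ ζ') (bd b') =
      ev (cochain₂ η) (Y b' + b') + ev (cochain₂ η') (X b' + b') :=
    eq_of_mem_Sup (S := ev (cochain₁ ζ') ∘ₗ bd)
      (T := ev (cochain₂ η) ∘ₗ (Y + LinearMap.id) + ev (cochain₂ η') ∘ₗ (X + LinearMap.id))
      (fun l hl => by
        match l, hl with
        | [a, b], _ =>
          simp only [faces, map_sub, map_add, map_zero, cone_single, ev_single, cochain₁, cochain₂,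
            bd_single, LinearMap.comp_apply, LinearMap.add_apply, LinearMap.id_apply, hX, hY,
            act_single, List.map]
          clear * -
          revert a b
          decide) hb'
  have h0 : ev cochain₀ (bd a) = ev (cochain₁ ζ) (X a + a) + ev (cochain₁ ζ') (Y a + a) :=
    eq_of_mem_Sup (S := ev cochain₀ ∘ₗ bd)
      (T := ev (cochain₁ ζ) ∘ₗ (X + LinearMap.id) + ev (cochain₁ ζ') ∘ₗ (Y + LinearMap.id))
      (fun l hl => by
        match l, hl with
        | [a], _ =>
          simp only [faces, map_sub, map_add, map_zero, ev_single, cochain₁, cochain₀,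
            bd_single, LinearMap.comp_apply, LinearMap.add_apply, LinearMap.id_apply, hX, hY,
            act_single, List.map]
          clear * -
          revert a
          decide) ha
  have h0' : ev cochain₀ (bd a) = (1 : ZMod 2) := by rw [hda]; simp [cochain₀]
  rw [hdb] at h1
  rw [hdb'] at h1'
  rw [hdc] at h2
  rw [hdc'] at h2'
  rw [hde] at h3
  simp only [map_add] at h3 h2 h2' h1 h1' h0
  have : (1 : ZMod 2) = 0 := by
    linear_combination h0 - h0' + h1 + h1' + h2 + h2' + h3
  exact one_ne_zero this

end Cochains

section NoLabel

variable [NormedAddCommGroup E] [NormedSpace ℝ E]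

/-- There is no labelling with at most three labels near each point which is equivariant for a
cyclic action of order five. -/
lemma no_cyclic_label (hE : Module.finrank ℝ E = 4) (f : E →ₗ[ℝ] E)
    (hf : ∀ x, f (f (f (f (f x)))) = x) (c : E → ZMod 5)
    (hcf : ∀ x, x ≠ 0 → c (f x) = c x + 3)
    (hc : ∀ x : E, x ≠ 0 → ∃ U ∈ nhds x, ∃ S : Finset (ZMod 5), S.card ≤ 3 ∧
      ∀ y ∈ U, y ≠ 0 → c y ∈ S) : False := by
  obtain ⟨a, ha, b, hb, z, hz, e, he, ha', hb', hz', he'⟩ :=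
    exists_cyclic_chains (R := ZMod 5) hE f hf
  have hinj : Function.Injective f := fun x y h => by rw [← hf x, h, hf y]
  obtain ⟨m, hm⟩ := exists_fine hc he
  have hF {k : ℕ} {z : Chain (ZMod 5) E} (hz : z ∈ Sup (ZMod 5) (Good k)) :
    act (ZMod 5) f z ∈ Sup (ZMod 5) (Good k) := act_good f hinj hz
  have hl {k : ℕ} {z : Chain (ZMod 5) E} (hz : z ∈ Sup (ZMod 5) (Good k)) :=
    labels_act (m := m) (ρ := (· + 3)) hcf hz
  refine cyclic_cochain_contradiction (labels_mem (c := c) (m := m) ha)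
    (labels_mem (c := c) (m := m) hb) (labels_mem (c := c) (m := m) hz)
    (e := labels (ZMod 5) c m e) hm rfl ?_ ?_ ?_ ?_
  · rw [bd_labels, ha', labels_nil]
  · rw [bd_labels, hb', map_sub, hl ha]
  · rw [bd_labels, hz']
    simp only [map_add, hl hb, hl (hF hb), hl (hF (hF hb)), hl (hF (hF (hF hb)))]
  · rw [bd_labels, he', map_sub, hl hz]

/-- There is no labelling with at most three labels near each point which is equivariant for the
action of a generalized quaternion group of order sixteen. -/
lemma no_quaternion_label (hE : Module.finrank ℝ E = 4) (f g : E →ₗ[ℝ] E)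
    (hfi : Function.Injective f) (hgi : Function.Injective g)
    (hf : ∀ x, f (f (f (f x))) = g (g x)) (hfg : ∀ x, f (g (f x)) = g x) (c : E → Fin 4)
    (hcf : ∀ x, x ≠ 0 → c (f x) = c x - 1) (hcg : ∀ x, x ≠ 0 → c (g x) = (c x).rev)
    (hc : ∀ x : E, x ≠ 0 → ∃ U ∈ nhds x, ∃ S : Finset (Fin 4), S.card ≤ 3 ∧
      ∀ y ∈ U, y ≠ 0 → c y ∈ S) : False := by
  obtain ⟨a, ha, b, hb, b', hb', z, hz, z', hz', e, he, hda, hdb, hdb', hdz, hdz', hde⟩ :=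
    exists_quaternion_chains hE f g hfi hgi hf hfg
  obtain ⟨m, hm⟩ := exists_fine hc he
  have hF {k : ℕ} {z : Chain (ZMod 2) E} (hz : z ∈ Sup (ZMod 2) (Good k)) :
    act (ZMod 2) f z ∈ Sup (ZMod 2) (Good k) := act_good f hfi hz
  have hG {k : ℕ} {z : Chain (ZMod 2) E} (hz : z ∈ Sup (ZMod 2) (Good k)) :
    act (ZMod 2) g z ∈ Sup (ZMod 2) (Good k) := act_good g hgi hz
  have hlF {k : ℕ} {z : Chain (ZMod 2) E} (hz : z ∈ Sup (ZMod 2) (Good k)) :=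
    labels_act (m := m) (ρ := (· - 1)) hcf hz
  have hlG {k : ℕ} {z : Chain (ZMod 2) E} (hz : z ∈ Sup (ZMod 2) (Good k)) :=
    labels_act (m := m) hcg hz
  refine dihedral_cochain_contradiction (labels_mem (c := c) (m := m) ha)
    (labels_mem (c := c) (m := m) hb) (labels_mem (c := c) (m := m) hb')
    (labels_mem (c := c) (m := m) hz) (labels_mem (c := c) (m := m) hz')
    (e := labels (ZMod 2) c m e) hm rfl rfl ?_ ?_ ?_ ?_ ?_ ?_
  · rw [bd_labels, hda, labels_nil]
  · rw [bd_labels, hdb, map_add, hlF ha]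
  · rw [bd_labels, hdb', map_add, hlG ha]
  · rw [bd_labels, hdz]
    simp only [map_add, hlF hb, hlF (hF hb), hlF (hF (hF hb)), hlG hb']
  · rw [bd_labels, hdz']
    simp only [map_add, hlG hb, hlF (hG hb), hlF hb']
  · rw [bd_labels, hde]
    simp only [map_add, hlF hz, hlF (hG hz'), hlG hz']

end NoLabel

end ListChain

/-- Equivariant selection for a free action. -/
lemma exists_equivariant_selection {G V X : Type*} [Group G] [MulAction G X]
    (hv₀ : Nonempty V)
    (H : Subgroup (G × Equiv.Perm V)) (Y : Set X)
    (hfree : ∀ h ∈ H, ∀ x ∈ Y, h.1 • x = x → h.2 = 1)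
    (A : X → Set V) (hA : ∀ x ∈ Y, (A x).Nonempty)
    (hY : ∀ h ∈ H, ∀ x ∈ Y, h.1 • x ∈ Y)
    (hH : ∀ h ∈ H, ∀ x ∈ Y, ∀ v ∈ A x, h.2 v ∈ A (h.1 • x)) :
    ∃ c : X → V, ∀ x ∈ Y, c x ∈ A x ∧ ∀ h ∈ H, c (h.1 • x) = h.2 (c x) := by
  classical
  let s : Setoid X :=
    { r := fun x y => ∃ h ∈ H, h.1 • x = y
      iseqv :=
        { refl := fun x => ⟨1, H.one_mem, by simp⟩
          symm := by
            rintro x y ⟨h, hh, rfl⟩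
            exact ⟨h⁻¹, H.inv_mem hh, by simp⟩
          trans := by
            rintro x y z ⟨h, hh, rfl⟩ ⟨k, hk, rfl⟩
            exact ⟨k * h, H.mul_mem hk hh, by simp [mul_smul]⟩ } }
  let rep : X → X := fun x => (Quotient.mk s x).out
  have hrep : ∀ x, ∃ h ∈ H, h.1 • rep x = x := fun x =>
    Quotient.exact (Quotient.out_eq (Quotient.mk s x))
  choose k hk hkx using hrep
  have hrY : ∀ x ∈ Y, rep x ∈ Y := by
    intro x hx
    have := hY _ (H.inv_mem (hk x)) x hx
    rwa [Prod.fst_inv, inv_smul_eq_iff.2 (hkx x).symm] at this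
  have hV : ∀ x, ∃ v, x ∈ Y → v ∈ A x := by
    intro x
    by_cases hx : x ∈ Y
    · exact (hA x hx).imp fun v hv _ => hv
    · exact ⟨hv₀.some, fun h => absurd h hx⟩
  choose f hf using hV
  refine ⟨fun x => (k x).2 (f (rep x)), fun x hx => ⟨?_, fun h hh => ?_⟩⟩
  · have := hH _ (hk x) _ (hrY x hx) _ (hf _ (hrY x hx))
    rwa [hkx] at this
  · have hr : rep (h.1 • x) = rep x := by
      refine congrArg Quotient.out (Quotient.sound (s := s) ?_)
      exact ⟨h⁻¹, H.inv_mem hh, by simp⟩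
    have h1 := hfree _ (H.mul_mem (H.inv_mem (hk (h.1 • x))) (H.mul_mem hh (hk x))) _
      (hrY x hx) (by
      have := hkx (h.1 • x)
      rw [hr] at this
      simp only [Prod.fst_mul, Prod.fst_inv, mul_smul, hkx x]
      rw [inv_smul_eq_iff, this])
    have h2 : (k (h.1 • x)).2 = h.2 * (k x).2 := by
      simpa [inv_mul_eq_one] using h1
    simp [hr, h2]

section PartialSums

variable {n : ℕ} [NeZero n] {x : Fin n → ℝ}

/-- The partial sums of the `n`-periodic extension of a vector. -/
def psum (x : Fin n → ℝ) (t : ℕ) : ℝ := ∑ i ∈ Finset.range t, x (Fin.ofNat n i)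

@[simp] lemma psum_zero : psum x 0 = 0 := by simp [psum]

lemma cyclicShift_ofNat (i : ℕ) : cyclicShift n x (Fin.ofNat n i) = x (Fin.ofNat n (i + 1)) := by
  obtain ⟨m, rfl⟩ := Nat.exists_eq_succ_of_ne_zero (NeZero.ne n)
  simp only [cyclicShift, finRotate_apply]
  congr 1
  ext
  simp [Fin.val_add]

lemma cyclicShift_iterate_ofNat (k i : ℕ) :
    (cyclicShift n)^[k] x (Fin.ofNat n i) = x (Fin.ofNat n (k + i)) := by
  induction k generalizing i with
  | zero => simp
  | succ k ih =>
    rw [Function.iterate_succ_apply', cyclicShift_ofNat, ih]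
    congr 2
    ring

lemma psum_cyclicShift_iterate (k t : ℕ) :
    psum ((cyclicShift n)^[k] x) t = psum x (k + t) - psum x k := by
  simp only [psum, cyclicShift_iterate_ofNat, Finset.sum_range_add, add_sub_cancel_left]

lemma psum_self : psum x n = ∑ i, x i := by
  rw [psum, ← Fin.sum_univ_eq_sum_range (fun i => x (Fin.ofNat n i))]
  simp

lemma cyclicShift_iterate_self : (cyclicShift n)^[n] x = x := by
  ext i
  have h := cyclicShift_iterate_ofNat (x := x) n i
  rwa [show Fin.ofNat n i = i by simp, show Fin.ofNat n (n + i) = i by ext; simp [Nat.mod_eq_of_lt]]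
    at h

lemma psum_add_self (hx : psum x n = 0) (t : ℕ) : psum x (n + t) = psum x t := by
  have := psum_cyclicShift_iterate (x := x) n t
  rw [cyclicShift_iterate_self, hx] at this
  linarith

lemma psum_mod (hx : psum x n = 0) (t : ℕ) : psum x (t % n) = psum x t := by
  induction t using Nat.strong_induction_on with
  | _ t ih =>
    rcases lt_or_ge t n with h | h
    · rw [Nat.mod_eq_of_lt h]
    · have hn : 0 < n := Nat.pos_of_neZero n
      rw [Nat.mod_eq_sub_mod h, ih _ (by omega), ← psum_add_self hx, Nat.add_sub_cancel' h]

lemma psum_rev (hx : psum x n = 0) {t : ℕ} (ht : t ≤ n) :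
    psum (revShift n x) t = - psum x (n - t) := by
  induction t with
  | zero => simp [hx]
  | succ t ih =>
    have h := ih (by omega)
    have h1 : psum x (n - t) = psum x (n - (t + 1)) + x (Fin.ofNat n (n - (t + 1))) := by
      rw [show n - t = n - (t + 1) + 1 by omega, psum, Finset.sum_range_succ, psum]
    have h2 : revShift n x (Fin.ofNat n t) = x (Fin.ofNat n (n - (t + 1))) := by
      unfold revShift
      congr 1
      ext
      simp only [Fin.val_rev, Fin.ofNat_eq_cast, Fin.val_natCast]
      rw [Nat.mod_eq_of_lt (by omega : t < n), Nat.mod_eq_of_lt (by omega)]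
    rw [psum, Finset.sum_range_succ, ← psum, h, h1, h2]
    ring

lemma psum_eq_sum_filter {t : ℕ} (ht : t ≤ n) :
    psum x t = ∑ i ∈ Finset.univ.filter (fun i : Fin n => (i : ℕ) < t), x i := by
  have h := Fin.sum_univ_eq_sum_range (fun i => if i < t then x (Fin.ofNat n i) else 0) n
  rw [Finset.sum_filter]
  simp only [Fin.ofNat_eq_cast, Fin.cast_val_eq_self] at h
  rw [h, ← Finset.sum_filter, psum]
  refine Finset.sum_congr ?_ fun i _ => rfl
  ext i
  simp
  omega

lemma sum_filter_eq_psum_sub {s t : ℕ} (hst : s ≤ t) (ht : t ≤ n) :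
    ∑ i ∈ Finset.univ.filter (fun i : Fin n => s ≤ (i : ℕ) ∧ (i : ℕ) < t), x i =
      psum x t - psum x s := by
  rw [psum_eq_sum_filter ht, psum_eq_sum_filter (hst.trans ht), eq_sub_iff_add_eq]
  simp only [Finset.sum_filter, ← Finset.sum_add_distrib]
  refine Finset.sum_congr rfl fun i _ => ?_
  split_ifs <;> first | omega | simp

lemma mem_Lset {a₁ a₂ a₃ a₄ : ℕ} (hn : a₁ + a₂ + a₃ + a₄ = n) (h : psum x n = 0)
    (h1 : psum x a₁ = 0) (h2 : psum x (a₁ + a₂) = 0) (h3 : psum x (a₁ + a₂ + a₃) = 0) :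
    x ∈ Lset n a₁ a₂ a₃ a₄ := by
  refine ⟨by rw [Wset, Set.mem_ofPred_eq, ← psum_self, h], ?_, ?_, ?_, ?_⟩
  · rw [← psum_eq_sum_filter (show a₁ ≤ n by omega), h1]
  · rw [sum_filter_eq_psum_sub (Nat.le_add_right _ _) (by omega), h1, h2, sub_zero]
  · rw [sum_filter_eq_psum_sub (Nat.le_add_right _ _) (by omega), h2, h3, sub_zero]
  · have := sum_filter_eq_psum_sub (x := x) (s := a₁ + a₂ + a₃) (t := n) (by omega) le_rfl
    simpa [h, h3] using this

lemma mem_dihArrangementUnion {a₁ a₂ a₃ a₄ m : ℕ} (hm : m < n)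
    (h : (cyclicShift n)^[m] x ∈ Lset n a₁ a₂ a₃ a₄) :
    x ∈ dihArrangementUnion n a₁ a₂ a₃ a₄ := by
  refine Or.inl (Set.mem_iUnion₂.2 ?_)
  rcases Nat.eq_zero_or_pos m with rfl | h0
  · exact ⟨0, by simpa using hm, x, h, rfl⟩
  · refine ⟨n - m, by simp; omega, _, h, ?_⟩
    rw [← Function.iterate_add_apply, Nat.sub_add_cancel hm.le, cyclicShift_iterate_self]

end PartialSums

section Quaternions

open scoped Quaternion

lemma epsQ_eq (n : ℕ) : epsQ n = Quaternion.ofComplex (Complex.exp (Real.pi / n * Complex.I)) := by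
  have h : (Real.pi / n : ℂ) = (Real.pi / n : ℝ) := by push_cast; rfl
  rw [h]
  ext <;> simp only [epsQ, Quaternion.coe_ofComplex, Quaternion.re_coeComplex,
    Quaternion.imI_coeComplex, Quaternion.imJ_coeComplex, Quaternion.imK_coeComplex,
    Complex.exp_ofReal_mul_I_re, Complex.exp_ofReal_mul_I_im]

lemma orderOf_epsQ {n : ℕ} (hn : n ≠ 0) : orderOf (epsQ n) = 2 * n := by
  have h := (Complex.isPrimitiveRoot_exp (2 * n) (by omega)).eq_orderOf
  rw [h, epsQ_eq]
  refine (orderOf_injective Quaternion.ofComplex.toMonoidHom ?_ _).trans ?_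
  · intro z w hzw
    exact Complex.ext (congrArg QuaternionAlgebra.re hzw) (congrArg QuaternionAlgebra.imI hzw)
  · congr 2
    push_cast
    field_simp

lemma epsQ_ne_zero (n : ℕ) : epsQ n ≠ 0 := norm_ne_zero_iff.1 (by simp [norm_epsQ])

lemma jQ_ne_zero : jQ ≠ 0 := norm_ne_zero_iff.1 (by simp [norm_jQ])

lemma jQ_mul_jQ : jQ * jQ = -1 := by
  ext <;> simp [Quaternion.re_mul, Quaternion.imI_mul, Quaternion.imJ_mul, Quaternion.imK_mul] <;>
    simp [jQ]

lemma epsQ_pow_self {n : ℕ} (hn : n ≠ 0) : epsQ n ^ n = -1 := by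
  have h : epsQ n ^ n * epsQ n ^ n = 1 := by
    rw [← pow_add, ← two_mul, ← orderOf_epsQ hn, pow_orderOf_eq_one]
  refine (mul_self_eq_one_iff.1 h).resolve_left fun h1 => ?_
  have := orderOf_dvd_of_pow_eq_one h1
  rw [orderOf_epsQ hn] at this
  have := Nat.le_of_dvd (by omega) this
  omega

lemma epsQ_mul_jQ_mul_epsQ (n : ℕ) : epsQ n * jQ * epsQ n = jQ := by
  have := Real.cos_sq_add_sin_sq (Real.pi / n)
  ext <;> simp [Quaternion.re_mul, Quaternion.imI_mul, Quaternion.imJ_mul, Quaternion.imK_mul] <;>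
    simp [jQ, epsQ] <;> linarith

lemma epsQ_pow_mul_jQ_mul_epsQ_pow (n k : ℕ) : epsQ n ^ k * jQ * epsQ n ^ k = jQ := by
  induction k with
  | zero => simp
  | succ k ih =>
    calc _ = epsQ n ^ k * (epsQ n * jQ * epsQ n) * epsQ n ^ k := by
          rw [pow_succ, mul_assoc, mul_assoc, ← pow_succ, pow_succ' _ k]; simp only [mul_assoc]
      _ = jQ := by rw [epsQ_mul_jQ_mul_epsQ, ih]

/-- The radial extension of an equivariant map. -/
lemma exists_radial_extension {n a₁ a₂ a₃ a₄ : ℕ} (h : ExistsQuatEquivariantMap n a₁ a₂ a₃ a₄) :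
    ∃ Φ : Quaternion ℝ → Fin n → ℝ, ContinuousOn Φ {0}ᶜ ∧
      (∀ x ≠ 0, Φ x ∈ Mdih n a₁ a₂ a₃ a₄) ∧
      (∀ k, ∀ x ≠ 0, Φ (epsQ n ^ k * x) = (cyclicShift n)^[k] (Φ x)) ∧
      ∀ x ≠ 0, Φ (jQ * x) = revShift n (Φ x) := by
  classical
  obtain ⟨F, hF, hε, hj⟩ := h
  have hu (x : Quaternion ℝ) (hx : x ≠ 0) : ‖‖x‖⁻¹ • x‖ = 1 := norm_smul_inv_norm (𝕜 := ℝ) hx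
  let Φ : Quaternion ℝ → Fin n → ℝ := fun x => if hx : x = 0 then 0 else (F ⟨_, hu x hx⟩).1
  have hΦ (x) (hx : x ≠ 0) : Φ x = (F ⟨_, hu x hx⟩).1 := dif_neg hx
  have hΦ' (x y) (hx : x ≠ 0) (hy) (h : ‖x‖⁻¹ • x = y) : Φ x = (F ⟨y, hy⟩).1 := by
    subst h; exact hΦ x hx
  have h1 (x) (hx : x ≠ 0) : Φ (epsQ n * x) = cyclicShift n (Φ x) := by
    rw [hΦ x hx, ← hε]
    exact hΦ' _ _ (mul_ne_zero (epsQ_ne_zero n) hx) _ (by simp [norm_epsQ])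
  refine ⟨Φ, ?_, fun x hx => hΦ x hx ▸ (F _).2, fun k x hx => ?_, fun x hx => ?_⟩
  · rw [continuousOn_iff_continuous_domRestrict]
    have : Set.domRestrict {0}ᶜ Φ = fun x : ({0}ᶜ : Set (Quaternion ℝ)) =>
        (F ⟨_, hu x.1 x.2⟩).1 := funext fun x => hΦ x.1 x.2
    rw [this]
    refine continuous_subtype_val.comp (hF.comp (Continuous.subtype_mk ?_ _))
    exact (continuous_subtype_val.norm.inv₀ fun x => norm_ne_zero_iff.2 x.2).smul
      continuous_subtype_val
  · induction k with
    | zero => simp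
    | succ k ih =>
      rw [Function.iterate_succ_apply', ← ih, pow_succ', mul_assoc,
        h1 _ (mul_ne_zero (pow_ne_zero _ (epsQ_ne_zero n)) hx)]
  · rw [hΦ x hx, ← hj]
    exact hΦ' _ _ (mul_ne_zero jQ_ne_zero hx) _ (by simp [norm_jQ])

/-- A labelling by maximal coordinates, equivariant for every symmetry of the coordinates which
is realized by conjugation on a fixed family of units. -/
lemma exists_maximal_label {V : Type*} [Fintype V] [Nonempty V] (y : Quaternion ℝ → V → ℝ)
    (hy : ∀ v, ContinuousOn (fun x => y x v) {0}ᶜ) (P : V → (Quaternion ℝ)ˣ)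
    (hP : Function.Injective P)
    (hS : ∀ x ≠ 0, ∃ S : Finset V, S.card ≤ 3 ∧ ∀ v, (∀ w, y x w ≤ y x v) → v ∈ S) :
    ∃ c : Quaternion ℝ → V,
      (∀ (u : (Quaternion ℝ)ˣ) (π : Equiv.Perm V), (∀ v, u * P v = P (π v) * u) →
        (∀ x ≠ 0, ∃ C, ∀ v, y (u * x) (π v) = y x v + C) → ∀ x ≠ 0, c (u * x) = π (c x)) ∧
      ∀ x ≠ 0, ∃ U ∈ nhds x, ∃ S : Finset V, S.card ≤ 3 ∧ ∀ x' ∈ U, x' ≠ 0 → c x' ∈ S := by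
  have hπ (π : Equiv.Perm V) (v : V) : π (π⁻¹ v) = v := π.apply_symm_apply v
  have hne (u : (Quaternion ℝ)ˣ) {x : Quaternion ℝ} (hx : x ≠ 0) : (u : Quaternion ℝ) * x ≠ 0 :=
    mul_ne_zero u.ne_zero hx
  let H : Subgroup ((Quaternion ℝ)ˣ × Equiv.Perm V) :=
    { carrier := {h | (∀ v, h.1 * P v = P (h.2 v) * h.1) ∧
        ∀ x ≠ 0, ∃ C, ∀ v, y (h.1 * x) (h.2 v) = y x v + C}
      one_mem' := ⟨by simp, fun x _ => ⟨0, by simp⟩⟩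
      mul_mem' := by
        rintro ⟨u, π⟩ ⟨u', π'⟩ ⟨h1, h2⟩ ⟨h1', h2'⟩
        refine ⟨fun v => ?_, fun x hx => ?_⟩
        · simp only [Prod.fst_mul, Prod.snd_mul, Equiv.Perm.mul_apply] at *
          rw [mul_assoc, h1', ← mul_assoc, h1, mul_assoc]
        · obtain ⟨C', hC'⟩ := h2' x hx
          obtain ⟨C, hC⟩ := h2 _ (hne u' hx)
          refine ⟨C' + C, fun v => ?_⟩
          simp only [Prod.fst_mul, Prod.snd_mul, Equiv.Perm.mul_apply, Units.val_mul] at *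
          rw [mul_assoc, hC, hC', add_assoc]
      inv_mem' := by
        rintro ⟨u, π⟩ ⟨h1, h2⟩
        refine ⟨fun v => ?_, fun x hx => ?_⟩
        · have := h1 (π⁻¹ v)
          simp only [Prod.fst_inv, Prod.snd_inv, hπ] at *
          rw [eq_mul_inv_iff_mul_eq, mul_assoc, inv_mul_eq_iff_eq_mul, this]
        · obtain ⟨C, hC⟩ := h2 _ (hne u⁻¹ hx)
          refine ⟨-C, fun v => ?_⟩
          have := hC (π⁻¹ v)
          simp only [Prod.fst_inv, Prod.snd_inv, hπ, Units.mul_inv_cancel_left] at *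
          linarith }
  have hsel := exists_equivariant_selection (G := (Quaternion ℝ)ˣ) (V := V) inferInstance H {0}ᶜ
    (hfree := by
      rintro ⟨u, π⟩ ⟨h1, -⟩ x hx hux
      obtain rfl : u = 1 := by
        ext1
        exact mul_right_cancel₀ hx (hux.trans (one_mul x).symm)
      refine Equiv.ext fun v => hP ?_
      simpa using (h1 v).symm)
    (A := fun x => {v | ∀ w, y x w ≤ y x v}) (fun x _ => Finite.exists_max (y x))
    (fun h _ x hx => hne h.1 hx)
    (by
      rintro ⟨u, π⟩ ⟨-, h2⟩ x hx v hv w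
      obtain ⟨C, hC⟩ := h2 x hx
      have h3 := hC (π⁻¹ w)
      have h4 := hv (π⁻¹ w)
      have h5 := hC v
      simp only [hπ] at h3
      change y (u * x) w ≤ y (u * x) (π v)
      linarith)
  obtain ⟨c, hc⟩ := hsel
  refine ⟨c, fun u π h1 h2 x hx => (hc x hx).2 (u, π) ⟨h1, h2⟩, fun x hx => ?_⟩
  obtain ⟨S, hS3, hS⟩ := hS x hx
  have hU : ∀ v, ∀ᶠ x' in nhds x, v ∉ S → ∃ w, y x' v < y x' w := by
    intro v
    by_cases hv : v ∈ S
    · exact .of_forall fun _ h => absurd hv h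
    · have : ∃ w, y x v < y x w := by
        by_contra! h
        exact hv (hS v h)
      obtain ⟨w, hw⟩ := this
      have ho : ({0}ᶜ : Set (Quaternion ℝ)) ∈ nhds x := isOpen_compl_singleton.mem_nhds hx
      filter_upwards [((hy v).continuousAt ho).eventually_lt ((hy w).continuousAt ho) hw]
        with x' h _ using ⟨w, h⟩
  refine ⟨_, Filter.eventually_all.2 hU, S, hS3, fun x' hx' h0 => ?_⟩
  by_contra h
  obtain ⟨w, hw⟩ := hx' _ h
  exact absurd ((hc x' h0).1 w) hw.not_ge

lemma continuousOn_psum {n : ℕ} [NeZero n] {Φ : Quaternion ℝ → Fin n → ℝ} {s : Set (Quaternion ℝ)}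
    (hΦ : ContinuousOn Φ s) (t : ℕ) : ContinuousOn (fun x => psum (Φ x) t) s :=
  continuousOn_finsetSum _ fun _ _ => (continuousOn_pi.1 hΦ) _

end Quaternions

section Main

/-- The power of `ε` of exponent `k`, as a unit. -/
def epsUnit (n k : ℕ) : (Quaternion ℝ)ˣ := Units.mk0 (epsQ n) (epsQ_ne_zero n) ^ k

/-- The quaternion `j`, as a unit. -/
def jUnit : (Quaternion ℝ)ˣ := Units.mk0 jQ jQ_ne_zero

lemma val_epsUnit (n k : ℕ) : (epsUnit n k : Quaternion ℝ) = epsQ n ^ k := by simp [epsUnit]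

lemma orderOf_epsUnit {n k m : ℕ} (hn : n ≠ 0) (hk : k * m = 2 * n) :
    orderOf (epsUnit n k) = m := by
  have h : orderOf (Units.mk0 (epsQ n) (epsQ_ne_zero n)) = 2 * n := by
    rw [← orderOf_units, Units.val_mk0, orderOf_epsQ hn]
  have hk0 : k ≠ 0 := by rintro rfl; omega
  rw [epsUnit, orderOf_pow_of_dvd hk0 (h ▸ ⟨m, hk.symm⟩), h, ← hk,
    Nat.mul_div_cancel_left _ (Nat.pos_of_ne_zero hk0)]

lemma epsUnit_mul_jUnit_mul_epsUnit (n k : ℕ) : epsUnit n k * jUnit * epsUnit n k = jUnit :=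
  Units.ext (by simpa [val_epsUnit, jUnit] using epsQ_pow_mul_jQ_mul_epsQ_pow n k)

lemma no_equivariant_map_five {n p r a₁ a₂ a₃ a₄ : ℕ} (hp : 0 < p) (hn : n = 5 * p) (hr : r < 4)
    (hα : ∀ z : Fin n → ℝ, haveI : NeZero n := ⟨by omega⟩
      (∀ t, t ≤ 5 → t ≠ r + 1 → psum z (t * p) = 0) → z ∈ Lset n a₁ a₂ a₃ a₄) :
    ¬ ExistsQuatEquivariantMap n a₁ a₂ a₃ a₄ := by
  have : NeZero n := ⟨by omega⟩
  intro hF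
  obtain ⟨Φ, hΦ, hM, hε, -⟩ := exists_radial_extension hF
  have hz (x) (hx : x ≠ 0) : psum (Φ x) n = 0 := psum_self.trans (hM x hx).1
  let y : Quaternion ℝ → ZMod 5 → ℝ := fun x v => psum (Φ x) (v.val * p)
  have hy (x) (hx : x ≠ 0) (t : ℕ) : psum (Φ x) (t * p) = y x t := by
    have h : t * p % n = t % 5 * p := by rw [hn, Nat.mul_mod_mul_right]
    rw [← psum_mod (hz x hx), h]
    simp only [y, ZMod.val_natCast]
  have hshift (x) (hx : x ≠ 0) (s t : ℕ) :
      psum ((cyclicShift n)^[s * p] (Φ x)) (t * p) = y x (s + t) - y x s := by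
    rw [psum_cyclicShift_iterate, ← add_mul, hy x hx, hy x hx, Nat.cast_add]
  have h5 : orderOf (epsUnit n (2 * p)) = 5 := orderOf_epsUnit (by omega) (by omega)
  set u := epsUnit n (2 * p) with hu
  have hu5 : u ^ 5 = 1 := by rw [← h5, pow_orderOf_eq_one]
  have huj : jUnit * u = u ^ 4 * jUnit := by
    have := epsUnit_mul_jUnit_mul_epsUnit n (2 * p)
    rw [← hu] at this
    calc jUnit * u = u ^ 5 * jUnit * u := by rw [hu5, one_mul]
      _ = u ^ 4 * (u * jUnit * u) := by simp only [pow_succ, mul_assoc]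
      _ = _ := by rw [this]
  obtain ⟨c, hc, hloc⟩ := exists_maximal_label y (fun v => continuousOn_psum hΦ _)
    (fun v => u ^ (4 * v.val) * jUnit)
    (fun v w h => by
      have := pow_eq_pow_iff_modEq.1 (mul_right_cancel h)
      rw [h5] at this
      clear h
      revert v w
      decide)
    (fun x hx => by
      refine ⟨Finset.univ.filter fun v => ∀ w, y x w ≤ y x v, ?_, fun v hv => by simpa using hv⟩
      by_contra! hS
      obtain ⟨v, hv⟩ : ∃ v, (Finset.univ.filter fun v => ∀ w, y x w ≤ y x v)ᶜ ⊆ {v} := by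
        rw [← Finset.card_le_one_iff_subset_singleton, Finset.card_compl, ZMod.card]
        omega
      have hv' (w) (hw : w ≠ v) : ∀ w', y x w' ≤ y x w := by
        by_contra h
        exact hw (by simpa using hv (by simpa using h : w ∈ _ᶜ))
      have hv'' (w w') (hw : w ≠ v) (hw' : w' ≠ v) : y x w = y x w' :=
        le_antisymm (hv' _ hw' _) (hv' _ hw _)
      let s : ℕ := (v - (r + 1 : ℕ)).val
      have hs5 : s < 5 := ZMod.val_lt _
      have hs : (s : ZMod 5) = v - (r + 1 : ℕ) := by simp [s]
      refine (hM x hx).2 (mem_dihArrangementUnion (m := s * p)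
        (hn ▸ Nat.mul_lt_mul_of_pos_right hs5 hp) (hα _ fun t ht htr => ?_))
      rw [hshift x hx, sub_eq_zero]
      have key : ∀ t, t ≤ 5 → t ≠ r + 1 → (s + t : ZMod 5) ≠ v := by
        intro t ht htr h
        rw [hs, sub_add_eq_add_sub, sub_eq_iff_eq_add, add_right_inj,
          ZMod.natCast_eq_natCast_iff'] at h
        omega
      refine hv'' _ _ (key t ht htr) ?_
      simpa using key 0 (by omega) (by omega))
  have hcu : ∀ x ≠ 0, c (u * x) = c x + 3 := by
    refine hc u (Equiv.addRight 3) (fun v => ?_) (fun x hx => ⟨- y x 2, fun v => ?_⟩)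
    · rw [mul_assoc, huj, ← mul_assoc, ← mul_assoc, ← pow_succ', ← pow_add]
      congr 1
      rw [pow_eq_pow_iff_modEq, h5]
      revert v
      decide
    · have : psum (Φ (u * x)) ((v + 3).val * p) =
          y x ((2 : ℕ) + ((v + 3).val : ZMod 5)) - y x (2 : ℕ) := by
        rw [hu, val_epsUnit, hε _ _ hx, hshift x hx]
      have hv : ((2 : ℕ) : ZMod 5) + (v + 3) = v := by
        clear this
        revert v
        decide
      rw [ZMod.natCast_zmod_val, hv, sub_eq_add_neg] at this
      exact this
  let f : Quaternion ℝ →ₗ[ℝ] Quaternion ℝ := LinearMap.mulLeft ℝ (u : Quaternion ℝ)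
  refine ListChain.no_cyclic_label (Quaternion.finrank_eq_four) f (fun x => ?_) c hcu hloc
  have : (u : Quaternion ℝ) ^ 5 = 1 := by rw [← Units.val_pow_eq_pow_val, hu5, Units.val_one]
  calc _ = (u : Quaternion ℝ) ^ 5 * x := by simp [f, pow_succ, mul_assoc]
    _ = x := by rw [this, one_mul]

lemma no_equivariant_map_four {n p : ℕ} (hp : 0 < p) (hn : n = 4 * p) :
    ¬ ExistsQuatEquivariantMap n p p p p := by
  have : NeZero n := ⟨by omega⟩
  intro hF
  obtain ⟨Φ, hΦ, hM, hε, hj⟩ := exists_radial_extension hF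
  have hz (x) (hx : x ≠ 0) : psum (Φ x) n = 0 := psum_self.trans (hM x hx).1
  let y : Quaternion ℝ → Fin 4 → ℝ := fun x v =>
    psum (Φ x) ((v.val + 1) * p) - psum (Φ x) (v.val * p)
  have hz4 (x) (hx : x ≠ 0) : psum (Φ x) (4 * p) = 0 :=
    (congrArg (psum (Φ x)) hn.symm).trans (hz x hx)
  have h8 : orderOf (epsUnit n p) = 8 := orderOf_epsUnit (by omega) (by omega)
  set u := epsUnit n p with hu
  have huj (k : ℕ) : u ^ k * jUnit * u ^ k = jUnit := by
    have := epsUnit_mul_jUnit_mul_epsUnit n (p * k)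
    rwa [show epsUnit n (p * k) = u ^ k by rw [hu, epsUnit, epsUnit, pow_mul]] at this
  have hu8 : u ^ 8 = 1 := by rw [← h8, pow_orderOf_eq_one]
  have hju (k : ℕ) : jUnit * u ^ k = u ^ (7 * k) * jUnit := by
    calc jUnit * u ^ k = (u ^ 8) ^ k * jUnit * u ^ k := by rw [hu8, one_pow, one_mul]
      _ = u ^ (7 * k) * (u ^ k * jUnit * u ^ k) := by
        rw [← pow_mul, show 8 * k = 7 * k + k by ring, pow_add]; simp only [mul_assoc]
      _ = _ := by rw [huj]
  obtain ⟨c, hc, hloc⟩ := exists_maximal_label y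
    (fun v => (continuousOn_psum hΦ _).sub (continuousOn_psum hΦ _))
    (fun v => u ^ (3 + 6 * v.val) * jUnit)
    (fun v w h => by
      have := pow_eq_pow_iff_modEq.1 (mul_right_cancel h)
      rw [h8] at this
      clear h
      revert v w
      decide)
    (fun x hx => by
      by_contra! hS
      have hmax (v) : ∀ w, y x w ≤ y x v := by
        obtain ⟨w, hw, hw'⟩ := hS (Finset.univ.erase v) (by simp)
        obtain rfl : w = v := by simpa using hw'
        exact hw
      have heq (v w) : y x v = y x w := le_antisymm (hmax w v) (hmax v w)
      have h0 := hz4 x hx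
      have h1 := heq 0 1
      have h2 := heq 0 2
      have h3 := heq 0 3
      simp [y] at h1 h2 h3
      refine (hM x hx).2 (mem_dihArrangementUnion (m := 0) (by omega) (mem_Lset (by omega)
        (hz x hx) ?_ ?_ ?_))
      · simp; linarith
      · rw [← two_mul]; simp; linarith
      · rw [show p + p + p = 3 * p by ring]; simp; linarith)
  have hcu : ∀ x ≠ 0, c (u * x) = c x - 1 := by
    refine hc u (Equiv.subRight 1) (fun v => ?_) (fun x hx => ⟨0, fun v => ?_⟩)
    · have h := hju 1
      rw [pow_one] at h
      rw [mul_assoc, h, ← mul_assoc, ← mul_assoc, ← pow_succ', ← pow_add]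
      congr 1
      rw [pow_eq_pow_iff_modEq, h8]
      revert v
      decide
    · have hs (t : ℕ) : psum (Φ (u * x)) (t * p) = psum (Φ x) ((t + 1) * p) - psum (Φ x) p := by
        rw [hu, val_epsUnit, hε _ _ hx, psum_cyclicShift_iterate, add_mul, one_mul, add_comm p]
      have h5 : psum (Φ x) ((4 + 1) * p) = psum (Φ x) p := by
        rw [add_mul, ← hn, one_mul, psum_add_self (hz x hx)]
      fin_cases v
      · change psum (Φ (u * x)) ((3 + 1) * p) - psum (Φ (u * x)) (3 * p) =
          psum (Φ x) ((0 + 1) * p) - psum (Φ x) (0 * p) + 0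
        rw [hs, hs, h5]
        simp [hz4 x hx]
      · change psum (Φ (u * x)) ((0 + 1) * p) - psum (Φ (u * x)) (0 * p) =
          psum (Φ x) ((1 + 1) * p) - psum (Φ x) (1 * p) + 0
        rw [hs, hs]
        simp
      · change psum (Φ (u * x)) ((1 + 1) * p) - psum (Φ (u * x)) (1 * p) =
          psum (Φ x) ((2 + 1) * p) - psum (Φ x) (2 * p) + 0
        rw [hs, hs]
        simp
      · change psum (Φ (u * x)) ((2 + 1) * p) - psum (Φ (u * x)) (2 * p) =
          psum (Φ x) ((3 + 1) * p) - psum (Φ x) (3 * p) + 0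
        rw [hs, hs]
        simp
  have hcj : ∀ x ≠ 0, c (jQ * x) = (c x).rev := by
    refine hc jUnit Fin.revPerm (fun v => ?_) (fun x hx => ⟨0, fun v => ?_⟩)
    · rw [← mul_assoc, hju]
      congr 2
      rw [pow_eq_pow_iff_modEq, h8]
      revert v
      decide
    · have hs (t : ℕ) (ht : t ≤ 4) : psum (Φ (jQ * x)) (t * p) = -psum (Φ x) ((4 - t) * p) := by
        rw [hj x hx, psum_rev (hz x hx) (by rw [hn]; exact Nat.mul_le_mul_right _ ht),
          show n - t * p = (4 - t) * p by rw [Nat.sub_mul, hn]]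
      have hv : (Fin.revPerm v).val = 3 - v.val := by simp [Fin.val_rev]
      simp only [y]
      rw [hv]
      change psum (Φ (jQ * x)) _ - psum (Φ (jQ * x)) _ = _
      rw [hs _ (by omega), hs _ (by omega), show 4 - (3 - v.val + 1) = v.val by omega,
        show 4 - (3 - v.val) = v.val + 1 by omega]
      ring
  let f : Quaternion ℝ →ₗ[ℝ] Quaternion ℝ := LinearMap.mulLeft ℝ (u : Quaternion ℝ)
  let g : Quaternion ℝ →ₗ[ℝ] Quaternion ℝ := LinearMap.mulLeft ℝ jQ
  have huv : (u : Quaternion ℝ) = epsQ n ^ p := val_epsUnit n p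
  refine ListChain.no_quaternion_label (Quaternion.finrank_eq_four) f g
    (mul_right_injective₀ u.ne_zero) (mul_right_injective₀ jQ_ne_zero) (fun x => ?_) (fun x => ?_)
    c hcu hcj hloc
  · calc _ = (epsQ n ^ n) * x := by simp [f, huv, hn, pow_mul', pow_succ, mul_assoc]
      _ = _ := by rw [epsQ_pow_self (NeZero.ne n), ← jQ_mul_jQ, mul_assoc]; rfl
  · calc _ = (epsQ n ^ p * jQ * epsQ n ^ p) * x := by simp [f, g, huv, mul_assoc]
      _ = _ := by rw [epsQ_pow_mul_jQ_mul_epsQ_pow]; rfl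

end Main

/-- If `(a₁,a₂,a₃,a₄)` is, up to cyclic rotation and/or reversal, equal to
`(p,p,p,p)` or `(p,p,p,2p)` for some positive integer `p`, then there is no continuous
`Q₄ₙ`-equivariant map `F : S³ → M_D(α)`. -/
theorem no_quaternion_equivariant_map (n a₁ a₂ a₃ a₄ : ℕ) (hn : 1 ≤ n)
    (h1 : 0 < a₁) (h2 : 0 < a₂) (h3 : 0 < a₃) (h4 : 0 < a₄)
    (hsum : a₁ + a₂ + a₃ + a₄ = n)
    (hα : ∃ p : ℕ, 0 < p ∧
      ((a₁, a₂, a₃, a₄) = (p, p, p, p) ∨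
       (a₁, a₂, a₃, a₄) = (p, p, p, 2 * p) ∨ (a₁, a₂, a₃, a₄) = (p, p, 2 * p, p) ∨
       (a₁, a₂, a₃, a₄) = (p, 2 * p, p, p) ∨ (a₁, a₂, a₃, a₄) = (2 * p, p, p, p))) :
    ¬ ExistsQuatEquivariantMap n a₁ a₂ a₃ a₄ := by
  obtain ⟨p, hp, hα⟩ := hα
  simp only [Prod.mk.injEq] at hα
  have : NeZero n := ⟨by omega⟩
  rcases hα with ⟨rfl, rfl, rfl, rfl⟩ | ⟨rfl, rfl, rfl, rfl⟩ | ⟨rfl, rfl, rfl, rfl⟩ |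
    ⟨rfl, rfl, rfl, rfl⟩ | ⟨rfl, rfl, rfl, rfl⟩
  · exact no_equivariant_map_four hp (by omega)
  · exact no_equivariant_map_five (r := 3) hp (by omega) (by omega) fun z h =>
      mem_Lset hsum
        (by convert h 5 (by omega) (by omega) using 2; omega)
        (by convert h 1 (by omega) (by omega) using 2; omega)
        (by convert h 2 (by omega) (by omega) using 2; omega)
        (by convert h 3 (by omega) (by omega) using 2; omega)
  · exact no_equivariant_map_five (r := 2) hp (by omega) (by omega) fun z h =>
      mem_Lset hsum
        (by convert h 5 (by omega) (by omega) using 2; omega)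
        (by convert h 1 (by omega) (by omega) using 2; omega)
        (by convert h 2 (by omega) (by omega) using 2; omega)
        (by convert h 4 (by omega) (by omega) using 2; omega)
  · exact no_equivariant_map_five (r := 1) hp (by omega) (by omega) fun z h =>
      mem_Lset hsum
        (by convert h 5 (by omega) (by omega) using 2; omega)
        (by convert h 1 (by omega) (by omega) using 2; omega)
        (by convert h 3 (by omega) (by omega) using 2; omega)
        (by convert h 4 (by omega) (by omega) using 2; omega)
  · exact no_equivariant_map_five (r := 0) hp (by omega) (by omega) fun z h =>
      mem_Lset hsum
        (by convert h 5 (by omega) (by omega) using 2; omega)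
        (by convert h 2 (by omega) (by omega) using 2)
        (by convert h 3 (by omega) (by omega) using 2; omega)
        (by convert h 4 (by omega) (by omega) using 2; omega)
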